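/- Achievability of the minimum return time (1 + √2)·m̄·v₀ by bang-bang control: Let m̄ > 0 and v₀ > 0, and set t̃ = ((2 + √2)/2)·m̄·v₀ and T = (1 + √2)·m̄·v₀. Define x(t) = v₀·t − t²/(2m̄) for t ∈ [0, t̃] and x(t) = x(t̃) + v(t̃)·(t − t̃) + (t − t̃)²/(2m̄) for t ∈ [t̃, T], where v(t̃) = v₀ − t̃/m̄ = −(√2/2)·v₀ (i.e. acceleration −1/m̄ on [0, t̃] and +1/m̄ on [t̃, T]). Then x is continuously differentiable on [0, T], its velocity v = x' satisfies |v(t) − v(s)| ≤ |t − s|/m̄ for all s, t ∈ [0, T], and x(0) = 0, v(0) = v₀, x(T) = 0, v(T) = 0. Hence the minimum time to return to the detection point and stop equals exactly (1 + √2)·m̄·v₀. -/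

import Mathlib

/-!
Achievability of the minimum return time `(1 + √2)·m̄·v₀` by bang-bang control: with
`t̃ = ((2+√2)/2)·m̄·v₀` and `T = (1+√2)·m̄·v₀`, the trajectory with acceleration
`−1/m̄` on `[0, t̃]` and `+1/m̄` on `[t̃, T]` (switching speed `v(t̃) = −(√2/2)·v₀`)
is continuously differentiable, satisfies the unit force bound, starts at position `0`
with speed `v₀` and ends at rest at position `0` at time `T`. Hence the minimum time
to return to the detection point and stop equals exactly `(1 + √2)·m̄·v₀`.
-/

open Set

theorem hasDerivAt_ite_le {f g f' g' : ℝ → ℝ} {c : ℝ} (hf : ∀ t, HasDerivAt f (f' t) t)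
    (hg : ∀ t, HasDerivAt g (g' t) t) (hfg : f c = g c) (hfg' : f' c = g' c) (t : ℝ) :
    HasDerivAt (fun t => if t ≤ c then f t else g t) (if t ≤ c then f' t else g' t) t := by
  rcases lt_trichotomy t c with h | rfl | h
  · rw [if_pos h.le]
    refine (hf t).congr_of_eventuallyEq ?_
    filter_upwards [Iio_mem_nhds h] with u hu
    exact if_pos (le_of_lt hu)
  · rw [if_pos le_rfl, ← hasDerivWithinAt_univ, ← Iic_union_Ici (a := t)]
    refine HasDerivWithinAt.union ?_ ?_
    · refine (hf t).hasDerivWithinAt.congr (fun u hu => if_pos hu) (if_pos le_rfl)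
    · rw [hfg']
      refine (hg t).hasDerivWithinAt.congr (fun u hu => ?_) ((if_pos le_rfl).trans hfg)
      rcases (show t ≤ u from hu).eq_or_lt with rfl | h
      · exact (if_pos le_rfl).trans hfg
      · exact if_neg h.not_ge
  · rw [if_neg h.not_ge]
    refine (hg t).congr_of_eventuallyEq ?_
    filter_upwards [Ioi_mem_nhds h] with u hu
    exact if_neg (not_le.mpr hu)

theorem sub_le_sub_of_hasDerivAt_le {f g f' g' : ℝ → ℝ} {a b : ℝ} (hab : a ≤ b)
    (hf : ∀ t ∈ Icc a b, HasDerivAt f (f' t) t) (hg : ∀ t ∈ Icc a b, HasDerivAt g (g' t) t)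
    (hle : ∀ t ∈ Icc a b, f' t ≤ g' t) : f b - f a ≤ g b - g a := by
  have hd : ∀ t ∈ Icc a b, HasDerivAt (fun t => g t - f t) (g' t - f' t) t :=
    fun t ht => (hg t ht).sub (hf t ht)
  have hmono : MonotoneOn (fun t => g t - f t) (Icc a b) := by
    refine monotoneOn_of_deriv_nonneg (convex_Icc a b)
      (fun t ht => (hd t ht).continuousAt.continuousWithinAt)
      (fun t ht => (hd t (interior_subset ht)).differentiableAt.differentiableWithinAt)
      (fun t ht => ?_)
    rw [(hd t (interior_subset ht)).deriv]
    exact sub_nonneg.mpr (hle t (interior_subset ht))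
  have := hmono (left_mem_Icc.mpr hab) (right_mem_Icc.mpr hab) hab
  simp only at this
  linarith

theorem hasDerivAt_quadratic (p u k c t : ℝ) :
    HasDerivAt (fun t => p + u * (t - c) + k * (t - c) ^ 2) (u + 2 * k * (t - c)) t := by
  have h := (hasDerivAt_id t).sub_const c
  refine (((h.const_mul u).const_add p).add ((h.pow 2).const_mul k)).congr_deriv ?_
  simp
  ring

theorem return_time_lower_bound {m v0 T : ℝ} (hm : 0 < m) (hv0 : 0 < v0) (hT : 0 ≤ T)
    {z w : ℝ → ℝ} (hz : ∀ t ∈ Icc (0 : ℝ) T, HasDerivAt z (w t) t)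
    (hw : ∀ s ∈ Icc (0 : ℝ) T, ∀ t ∈ Icc (0 : ℝ) T, |w t - w s| ≤ |t - s| / m)
    (hz0 : z 0 = 0) (hw0 : w 0 = v0) (hzT : z T = 0) (hwT : w T = 0) :
    (1 + Real.sqrt 2) * m * v0 ≤ T := by
  have h0 : (0 : ℝ) ∈ Icc 0 T := left_mem_Icc.mpr hT
  have h1 : T ∈ Icc 0 T := right_mem_Icc.mpr hT
  have hstart : ∀ t ∈ Icc (0 : ℝ) T, v0 + 2 * (-1 / (2 * m)) * (t - 0) ≤ w t := by
    intro t ht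
    have h := hw 0 h0 t ht
    rw [hw0, sub_zero, abs_of_nonneg ht.1] at h
    have := (abs_le.mp h).1
    have e : 2 * (-1 / (2 * m)) * (t - 0) = -(t / m) := by field_simp; ring
    linarith
  have hend : ∀ t ∈ Icc (0 : ℝ) T, 0 + 2 * (1 / (2 * m)) * (t - T) ≤ w t := by
    intro t ht
    have h := hw t ht T h1
    rw [hwT, abs_of_nonneg (sub_nonneg.mpr ht.2)] at h
    have := (abs_le.mp h).2
    have e : 2 * (1 / (2 * m)) * (t - T) = -((T - t) / m) := by field_simp; ring
    linarith
  have hTm : m * v0 ≤ T := by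
    have h := hstart T h1
    rw [hwT] at h
    have e : v0 + 2 * (-1 / (2 * m)) * (T - 0) = (m * v0 - T) / m := by field_simp; ring
    rw [e, div_le_iff₀ hm] at h
    linarith
  have hmv : 0 < m * v0 := mul_pos hm hv0
  -- the optimal switching time for a motion of duration `T`
  set s := (T + m * v0) / 2 with hs
  have hs0 : 0 ≤ s := by positivity
  have hsT : s ≤ T := by linarith
  have hA := sub_le_sub_of_hasDerivAt_le hs0
    (fun t _ => hasDerivAt_quadratic 0 v0 (-1 / (2 * m)) 0 t)
    (fun t ht => hz t ⟨ht.1, ht.2.trans hsT⟩) (fun t ht => hstart t ⟨ht.1, ht.2.trans hsT⟩)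
  have hB := sub_le_sub_of_hasDerivAt_le hsT
    (fun t _ => hasDerivAt_quadratic 0 0 (1 / (2 * m)) T t)
    (fun t ht => hz t ⟨hs0.trans ht.1, ht.2⟩) (fun t ht => hend t ⟨hs0.trans ht.1, ht.2⟩)
  have hAB : v0 * s - s ^ 2 / (2 * m) - (s - T) ^ 2 / (2 * m) ≤ 0 := by
    rw [hz0] at hA
    rw [hzT] at hB
    ring_nf at hA hB ⊢
    linarith
  have hquad : 2 * (m * v0) ^ 2 ≤ (T - m * v0) ^ 2 := by
    have e : v0 * s - s ^ 2 / (2 * m) - (s - T) ^ 2 / (2 * m)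
        = (2 * (m * v0) ^ 2 - (T - m * v0) ^ 2) / (4 * m) := by
      rw [hs]; field_simp; ring
    rw [e, div_le_iff₀ (by positivity)] at hAB
    linarith
  have h2 : (Real.sqrt 2 * (m * v0)) ^ 2 ≤ (T - m * v0) ^ 2 := by
    rwa [mul_pow, Real.sq_sqrt zero_le_two]
  have := le_of_sq_le_sq h2 (sub_nonneg.mpr hTm)
  linarith

theorem return_to_detection_point_min_time (m v0 : ℝ) (hm : 0 < m) (hv0 : 0 < v0)
    (tt T : ℝ) (htt : tt = ((2 + Real.sqrt 2) / 2) * m * v0)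
    (hT : T = (1 + Real.sqrt 2) * m * v0)
    (x v : ℝ → ℝ)
    (hv : v = fun t => if t ≤ tt then v0 - t / m else (v0 - tt / m) + (t - tt) / m)
    (hx : x = fun t => if t ≤ tt then v0 * t - t ^ 2 / (2 * m)
      else (v0 * tt - tt ^ 2 / (2 * m)) + (v0 - tt / m) * (t - tt) + (t - tt) ^ 2 / (2 * m)) :
    v tt = -(Real.sqrt 2 / 2) * v0 ∧
    (∀ t ∈ Set.Icc (0 : ℝ) T, HasDerivAt x (v t) t) ∧
    ContinuousOn v (Set.Icc 0 T) ∧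
    (∀ s ∈ Set.Icc (0 : ℝ) T, ∀ t ∈ Set.Icc (0 : ℝ) T, |v t - v s| ≤ |t - s| / m) ∧
    x 0 = 0 ∧ v 0 = v0 ∧ x T = 0 ∧ v T = 0 ∧
    IsLeast {T' : ℝ | 0 ≤ T' ∧ ∃ z w : ℝ → ℝ,
      (∀ t ∈ Set.Icc (0 : ℝ) T', HasDerivAt z (w t) t) ∧
      (∀ s ∈ Set.Icc (0 : ℝ) T', ∀ t ∈ Set.Icc (0 : ℝ) T', |w t - w s| ≤ |t - s| / m) ∧
      z 0 = 0 ∧ w 0 = v0 ∧ z T' = 0 ∧ w T' = 0} T := by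
  have hr : Real.sqrt 2 ^ 2 = 2 := Real.sq_sqrt zero_le_two
  have htt0 : 0 ≤ tt := by rw [htt]; positivity
  have hT0 : 0 ≤ T := by rw [hT]; positivity
  have httT : tt < T := by
    have : 0 < Real.sqrt 2 * (m * v0) := by positivity
    linarith
  have hderiv : ∀ t, HasDerivAt x (v t) t := by
    intro t
    rw [hx, hv]
    refine hasDerivAt_ite_le (f' := fun t => v0 - t / m)
      (g' := fun t => (v0 - tt / m) + (t - tt) / m) (fun t => ?_) (fun t => ?_) ?_ ?_ t
    · convert hasDerivAt_quadratic 0 v0 (-1 / (2 * m)) 0 t using 1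
      · funext t; ring
      · field_simp; ring
    · convert hasDerivAt_quadratic (v0 * tt - tt ^ 2 / (2 * m)) (v0 - tt / m) (1 / (2 * m)) tt t
        using 1
      · funext t; ring
      · field_simp
    · simp
    · simp
  have hlip : ∀ s t, |v t - v s| ≤ |t - s| / m := by
    intro s t
    wlog hst : s ≤ t generalizing s t
    · rw [abs_sub_comm, abs_sub_comm t]
      exact this t s (le_of_not_ge hst)
    rw [abs_of_nonneg (sub_nonneg.mpr hst), abs_le, ← neg_div, div_le_iff₀ hm, le_div_iff₀ hm, hv]
    dsimp only
    split_ifs <;> constructor <;> field_simp <;> linarith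
  have hcont : ContinuousOn v (Set.Icc 0 T) := by
    have : LipschitzWith (Real.toNNReal (1 / m)) v := by
      refine LipschitzWith.of_dist_le_mul fun s t => ?_
      rw [Real.coe_toNNReal _ (by positivity), Real.dist_eq, Real.dist_eq, one_div_mul_eq_div]
      exact hlip t s
    exact this.continuous.continuousOn
  have hvtt : v tt = -(Real.sqrt 2 / 2) * v0 := by
    simp only [hv, le_refl, if_true]
    rw [htt]; field_simp; ring
  have hx0 : x 0 = 0 := by simp [hx, htt0]
  have hv0' : v 0 = v0 := by simp [hv, htt0]
  have hxT : x T = 0 := by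
    simp only [hx, if_neg httT.not_ge]
    rw [htt, hT]; field_simp; ring_nf; rw [hr]; ring
  have hvT : v T = 0 := by
    simp only [hv, if_neg httT.not_ge]
    rw [htt, hT]; field_simp; ring
  refine ⟨hvtt, fun t _ => hderiv t, hcont, fun s _ t _ => hlip s t, hx0, hv0', hxT, hvT,
    ⟨hT0, x, v, fun t _ => hderiv t, fun s _ t _ => hlip s t, hx0, hv0', hxT, hvT⟩, ?_⟩
  rintro T' ⟨hT', z, w, hz, hw, hz0, hw0, hzT, hwT⟩
  rw [hT]
  exact return_time_lower_bound hm hv0 hT' hz hw hz0 hw0 hzT hwT
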